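/- Fix α ∈ [0,1), β ≥ 0, and let a, b : (0,∞) → ℝ be differentiable. For y ∈ ℝ³ \ {0} define h̃_{kl}(y) = |y|^{2β} ( b(|y|) h^α_{kl}(y) + (a(|y|) − b(|y|)) y_k y_l/|y|² ), where h^α_{kl}(y) = (1−α)δ_{kl} + α y_k y_l/|y|². Let ∇^{(α,β)}_j h̃_{kl} = ∂_j h̃_{kl} − Σ_m Γ^{(α,β) m}_{jk} h̃_{ml} − Σ_m Γ^{(α,β) m}_{jl} h̃_{mk}, with Γ^{(α,β) m}_{jk}(y) = (1+β)(α/|y|²)(δ_{jk} y_m − y_m y_j y_k/|y|²) + (β/|y|²)(y_k δ_{mj} + y_j δ_{mk} − y_m δ_{jk}), and define T̃^i(y) = Σ_{j,k,l} (h^{(α,β) ik}(y) h^{(α,β) jl}(y) − h^{(α,β) ij}(y) h^{(α,β) kl}(y)) ∇^{(α,β)}_j h̃_{kl}(y), where h^{(α,β) ij}(y) = |y|^{−2β}(1/(1−α))(δ_{ij} − α y_i y_j/|y|²). Then for every y ∈ ℝ³ \ {0}: Σ_i T̃^i(y) y_i/|y| = |y|^{−2β} ( 2(1+β)(a(|y|)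 − b(|y|))/|y| − 2 b'(|y|) ). -/

import Mathlib

noncomputable section

/-- Kronecker delta on `Fin 3`. -/
def kron (i j : Fin 3) : ℝ := if i = j then 1 else 0

/-- h^α_{kl}(y) = (1−α)δ_{kl} + α y_k y_l/|y|². -/
def halpha (α : ℝ) (y : EuclideanSpace ℝ (Fin 3)) (k l : Fin 3) : ℝ :=
  (1 - α) * kron k l + α * y k * y l / ‖y‖^2

/-- Inverse of the scaled metric:
h^{(α,β) ij}(y) = |y|^{−2β}(1/(1−α))(δ_{ij} − α y_i y_j/|y|²). -/
def habInv (α β : ℝ) (y : EuclideanSpace ℝ (Fin 3)) (i j : Fin 3) : ℝ :=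
  ‖y‖ ^ (-(2*β)) * (1/(1-α)) * (kron i j - α * y i * y j / ‖y‖^2)

/-- Christoffel symbols of h^{(α,β)}:
Γ^{(α,β) m}_{jk}(y) = (1+β)(α/|y|²)(δ_{jk}y_m − y_m y_j y_k/|y|²)
+ (β/|y|²)(y_k δ_{mj} + y_j δ_{mk} − y_m δ_{jk}). -/
def Gammaab (α β : ℝ) (y : EuclideanSpace ℝ (Fin 3)) (m j k : Fin 3) : ℝ :=
  (1+β) * (α/‖y‖^2) * (kron j k * y m - y m * y j * y k / ‖y‖^2)
    + (β/‖y‖^2) * (y k * kron m j + y j * kron m k - y m * kron j k)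

/-- Cartesian expression of the spherically symmetric scaled quasi-asymptotically flat
metric: h̃_{kl}(y) = |y|^{2β}(b(|y|)h^α_{kl}(y) + (a(|y|)−b(|y|)) y_k y_l/|y|²). -/
def htilde (α β : ℝ) (a b : ℝ → ℝ) (y : EuclideanSpace ℝ (Fin 3)) (k l : Fin 3) : ℝ :=
  ‖y‖ ^ (2*β) * (b ‖y‖ * halpha α y k l + (a ‖y‖ - b ‖y‖) * y k * y l / ‖y‖^2)

/-- The j-th partial derivative of a function on ℝ³. -/
def pd (j : Fin 3) (f : EuclideanSpace ℝ (Fin 3) → ℝ) (y : EuclideanSpace ℝ (Fin 3)) : ℝ :=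
  fderiv ℝ f y (EuclideanSpace.single j 1)

/-- Covariant derivative ∇^{(α,β)}_j h̃_{kl} of h̃ with respect to h^{(α,β)}. -/
def nablahtilde (α β : ℝ) (a b : ℝ → ℝ) (y : EuclideanSpace ℝ (Fin 3)) (j k l : Fin 3) : ℝ :=
  pd j (fun z => htilde α β a b z k l) y
    - (∑ m : Fin 3, Gammaab α β y m j k * htilde α β a b y m l)
    - (∑ m : Fin 3, Gammaab α β y m j l * htilde α β a b y m k)

/-- T̃^i(y) = Σ_{j,k,l}(h^{(α,β) ik}h^{(α,β) jl} − h^{(α,β) ij}h^{(α,β) kl})∇^{(α,β)}_j h̃_{kl}. -/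
def Ttilde (α β : ℝ) (a b : ℝ → ℝ) (y : EuclideanSpace ℝ (Fin 3)) (i : Fin 3) : ℝ :=
  ∑ j : Fin 3, ∑ k : Fin 3, ∑ l : Fin 3,
    (habInv α β y i k * habInv α β y j l - habInv α β y i j * habInv α β y k l)
      * nablahtilde α β a b y j k l

/-- For every y ≠ 0,
Σ_i T̃^i(y) y_i/|y| = |y|^{−2β}(2(1+β)(a(|y|) − b(|y|))/|y| − 2b'(|y|)). -/
theorem hasFDerivAt_norm_of_ne_zero {E : Type*} [NormedAddCommGroup E] [InnerProductSpace ℝ E]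
    {y : E} (hy : y ≠ 0) :
    HasFDerivAt (fun z : E => ‖z‖) (‖y‖⁻¹ • innerSL ℝ y) y := by
  have h := (hasStrictFDerivAt_norm_sq y).hasFDerivAt.sqrt (by positivity)
  simp only [Real.sqrt_sq (norm_nonneg _)] at h
  convert h using 1
  ext v
  simp
  ring

theorem pd_radial_tensor {y : EuclideanSpace ℝ (Fin 3)} (hy : y ≠ 0) {u v : ℝ → ℝ} {u' v' : ℝ}
    (hu : HasDerivAt u u' ‖y‖) (hv : HasDerivAt v v' ‖y‖) (c : ℝ) (j k l : Fin 3) :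
    pd j (fun z => u ‖z‖ * c + v ‖z‖ * (z k * z l)) y
      = u' * (y j / ‖y‖) * c + v' * (y j / ‖y‖) * (y k * y l)
        + v ‖y‖ * (kron j k * y l + kron j l * y k) := by
  have hn := hasFDerivAt_norm_of_ne_zero hy
  have hp (i : Fin 3) : HasFDerivAt (fun z : EuclideanSpace ℝ (Fin 3) => z i)
      (EuclideanSpace.proj i : EuclideanSpace ℝ (Fin 3) →L[ℝ] ℝ) y :=
    (EuclideanSpace.proj i : EuclideanSpace ℝ (Fin 3) →L[ℝ] ℝ).hasFDerivAt
  have h := ((hu.comp_hasFDerivAt y hn).mul_const c).add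
    ((hv.comp_hasFDerivAt y hn).mul ((hp k).mul (hp l)))
  have h' : HasFDerivAt (fun z : EuclideanSpace ℝ (Fin 3) =>
      u ‖z‖ * c + v ‖z‖ * (z k * z l)) _ y := h
  rw [pd, h'.fderiv]
  simp [kron, EuclideanSpace.inner_single_right, @eq_comm _ k, @eq_comm _ l]
  split_ifs <;> ring

theorem sum_sq_div_norm {y : EuclideanSpace ℝ (Fin 3)} (hy : y ≠ 0) :
    (y 0 / ‖y‖) ^ 2 + (y 1 / ‖y‖) ^ 2 + (y 2 / ‖y‖) ^ 2 = 1 := by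
  have h := EuclideanSpace.real_norm_sq_eq y
  rw [Fin.sum_univ_three] at h
  have : ‖y‖ ≠ 0 := norm_ne_zero_iff.mpr hy
  field_simp
  linarith

theorem sum_mul_kron (f : Fin 3 → ℝ) (j : Fin 3) : ∑ m, f m * kron m j = f j := by
  simp [kron]

theorem kron_comm (i j : Fin 3) : kron i j = kron j i := by
  simp [kron, eq_comm]

theorem htilde_eq_projections (α β : ℝ) (a b : ℝ → ℝ) {y : EuclideanSpace ℝ (Fin 3)}
    (hy : y ≠ 0) (k l : Fin 3) :
    htilde α β a b y k l = ‖y‖ ^ (2 * β) *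
      (b ‖y‖ * (1 - α) * (kron k l - y k / ‖y‖ * (y l / ‖y‖))
        + a ‖y‖ * (y k / ‖y‖ * (y l / ‖y‖))) := by
  have : ‖y‖ ≠ 0 := norm_ne_zero_iff.mpr hy
  simp only [htilde, halpha]
  field_simp
  ring

theorem pd_htilde (α β : ℝ) (a b : ℝ → ℝ) {y : EuclideanSpace ℝ (Fin 3)} (hy : y ≠ 0)
    (ha : DifferentiableAt ℝ a ‖y‖) (hb : DifferentiableAt ℝ b ‖y‖) (j k l : Fin 3) :
    pd j (fun z => htilde α β a b z k l) y = ‖y‖ ^ (2 * β) *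
      ((2 * β * b ‖y‖ / ‖y‖ + deriv b ‖y‖) * (1 - α) * (y j / ‖y‖) * kron k l
        + ((2 * β - 2) * (a ‖y‖ - (1 - α) * b ‖y‖) / ‖y‖ + (deriv a ‖y‖ - (1 - α) * deriv b ‖y‖))
          * (y j / ‖y‖) * (y k / ‖y‖) * (y l / ‖y‖)
        + (a ‖y‖ - (1 - α) * b ‖y‖) / ‖y‖ *
          (kron j k * (y l / ‖y‖) + kron j l * (y k / ‖y‖))) := by
  have hr : ‖y‖ ≠ 0 := norm_ne_zero_iff.mpr hy
  have hpow := Real.hasDerivAt_rpow_const (x := ‖y‖) (p := 2 * β) (Or.inl hr)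
  rw [Real.rpow_sub_one hr] at hpow
  have hu := (hpow.mul hb.hasDerivAt).mul_const (1 - α)
  have hv := (hpow.mul (ha.hasDerivAt.sub (hb.hasDerivAt.const_mul (1 - α)))).div
    ((hasDerivAt_id ‖y‖).pow 2) (by simpa using hr)
  have hf : (fun z => htilde α β a b z k l) = fun z : EuclideanSpace ℝ (Fin 3) =>
      (fun r : ℝ => r ^ (2 * β) * b r * (1 - α)) ‖z‖ * kron k l
        + (fun r : ℝ => r ^ (2 * β) * (a r - (1 - α) * b r) / r ^ 2) ‖z‖ * (z k * z l) := by
    funext z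
    simp only [htilde, halpha]
    ring
  rw [hf]
  refine (pd_radial_tensor hy hu hv (kron k l) j k l).trans ?_
  simp
  field_simp
  ring

theorem sum_Gammaab_mul_htilde (α β : ℝ) (a b : ℝ → ℝ) {y : EuclideanSpace ℝ (Fin 3)}
    (hy : y ≠ 0) (j k l : Fin 3) :
    ∑ m, Gammaab α β y m j k * htilde α β a b y m l = 1 / ‖y‖ *
      (((1 + β) * α * (kron j k - y j / ‖y‖ * (y k / ‖y‖)) - β * kron j k)
          * (‖y‖ ^ (2 * β) * a ‖y‖ * (y l / ‖y‖))
        + β * (y k / ‖y‖) * htilde α β a b y j l + β * (y j / ‖y‖) * htilde α β a b y k l) := by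
  have hr : ‖y‖ ≠ 0 := norm_ne_zero_iff.mpr hy
  have hΓ (m : Fin 3) : Gammaab α β y m j k = 1 / ‖y‖ *
      (((1 + β) * α * (kron j k - y j / ‖y‖ * (y k / ‖y‖)) - β * kron j k) * (y m / ‖y‖)
        + β * (y k / ‖y‖ * kron m j + y j / ‖y‖ * kron m k)) := by
    simp only [Gammaab]
    field_simp
    ring
  have hradial : ∑ m, y m / ‖y‖ * htilde α β a b y m l
      = ‖y‖ ^ (2 * β) * a ‖y‖ * (y l / ‖y‖) := by
    have hk := sum_mul_kron (fun i => y i / ‖y‖) l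
    have hn := sum_sq_div_norm hy
    simp only [htilde_eq_projections α β a b hy, Fin.sum_univ_three] at hk ⊢
    linear_combination ‖y‖ ^ (2 * β) * (b ‖y‖ * (1 - α) * hk
      + (a ‖y‖ - b ‖y‖ * (1 - α)) * (y l / ‖y‖) * hn)
  have hj := sum_mul_kron (fun m => htilde α β a b y m l) j
  have hk := sum_mul_kron (fun m => htilde α β a b y m l) k
  simp only [hΓ]
  rw [← hradial, ← hj, ← hk]
  simp only [Fin.sum_univ_three]
  ring

theorem nablahtilde_eq (α β : ℝ) (a b : ℝ → ℝ) {y : EuclideanSpace ℝ (Fin 3)} (hy : y ≠ 0)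
    (ha : DifferentiableAt ℝ a ‖y‖) (hb : DifferentiableAt ℝ b ‖y‖) (j k l : Fin 3) :
    nablahtilde α β a b y j k l = ‖y‖ ^ (2 * β) *
      (deriv a ‖y‖ * (y j / ‖y‖) * (y k / ‖y‖) * (y l / ‖y‖)
        + deriv b ‖y‖ * (1 - α) * (y j / ‖y‖) * (kron k l - y k / ‖y‖ * (y l / ‖y‖))
        + (1 + β) * (1 - α) * (a ‖y‖ - b ‖y‖) / ‖y‖ *
          ((kron j k - y j / ‖y‖ * (y k / ‖y‖)) * (y l / ‖y‖)
            + (kron j l - y j / ‖y‖ * (y l / ‖y‖)) * (y k / ‖y‖))) := by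
  rw [nablahtilde, pd_htilde α β a b hy ha hb, sum_Gammaab_mul_htilde α β a b hy,
    sum_Gammaab_mul_htilde α β a b hy]
  simp only [htilde_eq_projections α β a b hy, kron_comm l k]
  ring

theorem sum_contract_eigenvector {n : Fin 3 → ℝ} {H : Fin 3 → Fin 3 → ℝ} {S : ℝ}
    (hH : ∀ k, ∑ i, n i * H i k = S * n k) (D : Fin 3 → Fin 3 → Fin 3 → ℝ) :
    ∑ i, (∑ j, ∑ k, ∑ l, (H i k * H j l - H i j * H k l) * D j k l) * n i
      = S * ∑ p, ∑ q, H p q * (∑ i, n i * D p i q - ∑ i, n i * D i p q) := by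
  have h : S * ∑ p, ∑ q, H p q * (∑ i, n i * D p i q - ∑ i, n i * D i p q)
      = ∑ p, ∑ q, H p q * ∑ k, (S * n k) * (D p k q - D k p q) := by
    simp only [Fin.sum_univ_three]
    ring
  rw [h]
  simp only [← hH, Fin.sum_univ_three]
  ring

/-- For every y ≠ 0,
Σ_i T̃^i(y) y_i/|y| = |y|^{−2β}(2(1+β)(a(|y|) − b(|y|))/|y| − 2b'(|y|)). -/
theorem Ttilde_radial_component (α β : ℝ) (hα : α ∈ Set.Ico (0:ℝ) 1) (hβ : 0 ≤ β)
    (a b : ℝ → ℝ)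
    (ha : ∀ r > (0:ℝ), DifferentiableAt ℝ a r)
    (hb : ∀ r > (0:ℝ), DifferentiableAt ℝ b r)
    (y : EuclideanSpace ℝ (Fin 3)) (hy : y ≠ 0) :
    ∑ i : Fin 3, Ttilde α β a b y i * y i / ‖y‖
      = ‖y‖ ^ (-(2*β)) * (2 * (1+β) * (a ‖y‖ - b ‖y‖) / ‖y‖ - 2 * deriv b ‖y‖) := by
  have hr : ‖y‖ ≠ 0 := norm_ne_zero_iff.mpr hy
  have hα' : 1 - α ≠ 0 := by linarith [hα.2]
  have hR : ‖y‖ ^ (-(2 * β)) * ‖y‖ ^ (2 * β) = 1 := by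
    rw [← Real.rpow_add (norm_pos_iff.mpr hy)]
    simp
  have hn := sum_sq_div_norm hy
  have hk := sum_mul_kron (fun i => y i / ‖y‖)
  have hInv (i j : Fin 3) : habInv α β y i j = ‖y‖ ^ (-(2 * β)) * (1 / (1 - α)) *
      (kron i j - α * (y i / ‖y‖) * (y j / ‖y‖)) := by
    rw [habInv]
    field_simp
  have hH (k : Fin 3) :
      ∑ i, y i / ‖y‖ * habInv α β y i k = ‖y‖ ^ (-(2 * β)) * (y k / ‖y‖) := by
    have hkk := hk k
    have hc : 1 / (1 - α) * (1 - α) = 1 := by field_simp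
    simp only [hInv, Fin.sum_univ_three] at hkk ⊢
    linear_combination ‖y‖ ^ (-(2 * β)) * (1 / (1 - α) * hkk
      - 1 / (1 - α) * α * (y k / ‖y‖) * hn + (y k / ‖y‖) * hc)
  have hdiff (p q : Fin 3) :
      ∑ i, y i / ‖y‖ * nablahtilde α β a b y p i q - ∑ i, y i / ‖y‖ * nablahtilde α β a b y i p q
        = ‖y‖ ^ (2 * β) * (1 - α) * ((1 + β) * (a ‖y‖ - b ‖y‖) / ‖y‖ - deriv b ‖y‖) *
          (kron p q - y p / ‖y‖ * (y q / ‖y‖)) := by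
    have hq := hk q
    simp only [nablahtilde_eq α β a b hy (ha _ (norm_pos_iff.mpr hy)) (hb _ (norm_pos_iff.mpr hy)),
      kron_comm p, Fin.sum_univ_three] at hq ⊢
    set G := (1 + β) * (1 - α) * (a ‖y‖ - b ‖y‖) / ‖y‖ with hG
    linear_combination ‖y‖ ^ (2 * β) * (
      (deriv b ‖y‖ * (1 - α) * (y p / ‖y‖) - G * (y p / ‖y‖)) * hq
      + (-(deriv b ‖y‖ * (1 - α)) * (y p / ‖y‖) * (y q / ‖y‖) + G * (y p / ‖y‖) * (y q / ‖y‖)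
        + (G - deriv b ‖y‖ * (1 - α)) * (kron q p - y p / ‖y‖ * (y q / ‖y‖))) * hn)
  have htrace : ∑ p : Fin 3, ∑ q : Fin 3, (kron p q - α * (y p / ‖y‖) * (y q / ‖y‖)) *
      (kron p q - y p / ‖y‖ * (y q / ‖y‖)) = 2 := by
    simp [Fin.sum_univ_three, kron]
    linear_combination (α * ((y 0 / ‖y‖) ^ 2 + (y 1 / ‖y‖) ^ 2 + (y 2 / ‖y‖) ^ 2) - 1) * hn
  simp only [mul_div_assoc (Ttilde α β a b y _)]
  simp only [Ttilde]
  rw [sum_contract_eigenvector (n := fun i => y i / ‖y‖) hH]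
  have hfactor (p q : Fin 3) : habInv α β y p q * (‖y‖ ^ (2 * β) * (1 - α) *
      ((1 + β) * (a ‖y‖ - b ‖y‖) / ‖y‖ - deriv b ‖y‖) * (kron p q - y p / ‖y‖ * (y q / ‖y‖)))
      = ((1 + β) * (a ‖y‖ - b ‖y‖) / ‖y‖ - deriv b ‖y‖) *
        ((kron p q - α * (y p / ‖y‖) * (y q / ‖y‖)) * (kron p q - y p / ‖y‖ * (y q / ‖y‖))) := by
    have hc : ‖y‖ ^ (-(2 * β)) * ‖y‖ ^ (2 * β) * (1 / (1 - α) * (1 - α)) = 1 := by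
      rw [hR]
      field_simp
    rw [hInv]
    linear_combination ((1 + β) * (a ‖y‖ - b ‖y‖) / ‖y‖ - deriv b ‖y‖) *
      ((kron p q - α * (y p / ‖y‖) * (y q / ‖y‖)) * (kron p q - y p / ‖y‖ * (y q / ‖y‖))) * hc
  simp only [hdiff, hfactor, ← Finset.mul_sum, htrace]
  ring

end
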